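/- Let t < T, let ψ_1, ψ_2, ψ_3 be continuously differentiable real functions on [t,T], let (φ_j)_{j≥0} be the normalized Legendre system on [t,T], and let C_{j_3 j_2 j_1} = ∫_t^T ψ_3(t_3)φ_{j_3}(t_3) ∫_t^{t_3} ψ_2(t_2)φ_{j_2}(t_2) ∫_t^{t_2} ψ_1(t_1)φ_{j_1}(t_1) dt_1 dt_2 dt_3, and I_3 = ‖K‖²_{L²([t,T]³)} for the corresponding kernel K. Then there exists a constant C, independent of p, such that for all integers p ≥ 1: 0 ≤ I_3 − Σ_{j_1,j_2,j_3=0}^{p} C_{j_3 j_2 j_1}² ≤ C/p. -/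

import Mathlib

open MeasureTheory

/-- Iterated simplex integral with lower limit `a`: for a list `[g₁, …, gₙ]`
(outermost integrand first),
`simplexIntegral a [g₁, …, gₙ] b = ∫_a^b g₁(s) · simplexIntegral a [g₂, …, gₙ] s ds`. -/
noncomputable def simplexIntegral (a : ℝ) : List (ℝ → ℝ) → ℝ → ℝ
  | [], _ => 1
  | f :: fs, b => ∫ s in a..b, f s * simplexIntegral a fs s

/-- The kernel `K(t₁,…,t_k) = ψ₁(t₁)⋯ψ_k(t_k)` for `t₁ < ⋯ < t_k`, and `0` otherwise. -/
noncomputable def kernelK {k : ℕ} (ψ : Fin k → ℝ → ℝ) (x : Fin k → ℝ) : ℝ :=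
  if StrictMono x then ∏ l, ψ l (x l) else 0

/-- The product measure on `[t,T]^k`. -/
noncomputable def boxMeasure (t T : ℝ) (k : ℕ) : Measure (Fin k → ℝ) :=
  Measure.pi fun _ => volume.restrict (Set.Icc t T)

/-- The Legendre polynomial `P_n(x) = (1/(2^n n!)) dⁿ/dxⁿ (x²−1)ⁿ` (Rodrigues formula). -/
noncomputable def legendreP (n : ℕ) (x : ℝ) : ℝ :=
  (1 / (2 ^ n * (Nat.factorial n) : ℝ)) * iteratedDeriv n (fun y : ℝ => (y ^ 2 - 1) ^ n) x

/-- The normalized Legendre system on `[t,T]`: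
`φ_j(x) = √((2j+1)/(T−t)) · P_j((2x − (T+t))/(T−t))`. -/
noncomputable def legendreSys (t T : ℝ) (j : ℕ) (x : ℝ) : ℝ :=
  Real.sqrt ((2 * (j : ℝ) + 1) / (T - t)) * legendreP j ((2 * x - (T + t)) / (T - t))

/-- The iterated simplex Fourier–Legendre coefficient
`C_{j_k…j_1} = ∫_t^T ψ_k(t_k)φ_{j_k}(t_k) ⋯ ∫_t^{t_2} ψ_1(t_1)φ_{j_1}(t_1) dt_1⋯dt_k`. -/
noncomputable def legCoef (t T : ℝ) {k : ℕ} (ψ : Fin k → ℝ → ℝ) (j : Fin k → ℕ) : ℝ :=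
  simplexIntegral t
    ((List.ofFn fun l => fun s : ℝ => ψ l s * legendreSys t T (j l) s).reverse) T

/-- A measurable function bounded by a constant. -/
structure IsBddMeas {X : Type*} [MeasurableSpace X] (f : X → ℝ) : Prop where
  measurable : Measurable f
  bound : ∃ C : ℝ, ∀ x, |f x| ≤ C

namespace IsBddMeas

variable {X Y : Type*} [MeasurableSpace X] [MeasurableSpace Y]

lemma const (c : ℝ) : IsBddMeas fun _ : X => c := ⟨measurable_const, |c|, fun _ => le_rfl⟩

lemma mul {f g : X → ℝ} (hf : IsBddMeas f) (hg : IsBddMeas g) :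
    IsBddMeas fun x => f x * g x := by
  obtain ⟨A, hA⟩ := hf.bound
  obtain ⟨B, hB⟩ := hg.bound
  refine ⟨hf.measurable.mul hg.measurable, A * B, fun x => ?_⟩
  rw [abs_mul]
  exact mul_le_mul (hA x) (hB x) (abs_nonneg _) ((abs_nonneg _).trans (hA x))

lemma add {f g : X → ℝ} (hf : IsBddMeas f) (hg : IsBddMeas g) :
    IsBddMeas fun x => f x + g x := by
  obtain ⟨A, hA⟩ := hf.bound
  obtain ⟨B, hB⟩ := hg.bound
  exact ⟨hf.measurable.add hg.measurable, A + B,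
    fun x => (abs_add_le _ _).trans (add_le_add (hA x) (hB x))⟩

lemma sub {f g : X → ℝ} (hf : IsBddMeas f) (hg : IsBddMeas g) :
    IsBddMeas fun x => f x - g x := by
  simpa [sub_eq_add_neg] using hf.add ((const (-1)).mul hg)

lemma sq {f : X → ℝ} (hf : IsBddMeas f) : IsBddMeas fun x => f x ^ 2 := by
  simpa [pow_two] using hf.mul hf

lemma sum {ι : Type*} (s : Finset ι) {f : ι → X → ℝ} (hf : ∀ i, IsBddMeas (f i)) :
    IsBddMeas fun x => ∑ i ∈ s, f i x := by
  classical
  induction s using Finset.induction_on with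
  | empty => simpa using const 0
  | insert i s hi ih => simpa [Finset.sum_insert hi] using (hf i).add ih

lemma comp {f : X → ℝ} (hf : IsBddMeas f) {g : Y → X} (hg : Measurable g) :
    IsBddMeas fun y => f (g y) := by
  obtain ⟨A, hA⟩ := hf.bound
  exact ⟨hf.measurable.comp hg, A, fun y => hA _⟩

lemma integrable {f : X → ℝ} (hf : IsBddMeas f) (μ : Measure X) [IsFiniteMeasure μ] :
    Integrable f μ := by
  obtain ⟨A, hA⟩ := hf.bound
  exact Integrable.of_bound hf.measurable.aestronglyMeasurable A (ae_of_all _ hA)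

lemma integral_fst {F : X × Y → ℝ} (hF : IsBddMeas F) (μ : Measure X) [IsFiniteMeasure μ] :
    IsBddMeas fun y => ∫ x, F (x, y) ∂μ := by
  obtain ⟨A, hA⟩ := hF.bound
  refine ⟨(hF.measurable.stronglyMeasurable.integral_prod_left').measurable,
    A * μ.real Set.univ, fun y => ?_⟩
  exact norm_integral_le_of_norm_le_const (f := fun x => F (x, y)) (ae_of_all _ fun x => hA (x, y))

lemma integral_snd {F : X × Y → ℝ} (hF : IsBddMeas F) (ν : Measure Y) [IsFiniteMeasure ν] :
    IsBddMeas fun x => ∫ y, F (x, y) ∂ν :=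
  (hF.comp measurable_swap).integral_fst ν

end IsBddMeas

section SqDefect

variable {X Y : Type*} [MeasurableSpace X] [MeasurableSpace Y] {ι κ : Type*}

/-- A finite family of bounded measurable functions orthonormal in `L²(μ)`. -/
structure IsBddOrtho [DecidableEq ι] (μ : Measure X) (φ : ι → X → ℝ) : Prop where
  bddMeas : ∀ i, IsBddMeas (φ i)
  ortho : ∀ i j, ∫ x, φ i x * φ j x ∂μ = if i = j then 1 else 0

lemma IsBddOrtho.prod [DecidableEq ι] [DecidableEq κ] {μ : Measure X} {ν : Measure Y}
    [IsFiniteMeasure μ] [IsFiniteMeasure ν] {φ : ι → X → ℝ} {χ : κ → Y → ℝ}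
    (hφ : IsBddOrtho μ φ) (hχ : IsBddOrtho ν χ) :
    IsBddOrtho (μ.prod ν) fun (i : ι × κ) (z : X × Y) => φ i.1 z.1 * χ i.2 z.2 where
  bddMeas i := ((hφ.bddMeas _).comp measurable_fst).mul ((hχ.bddMeas _).comp measurable_snd)
  ortho i j := by
    have h (z : X × Y) : φ i.1 z.1 * χ i.2 z.2 * (φ j.1 z.1 * χ j.2 z.2) =
      (φ i.1 z.1 * φ j.1 z.1) * (χ i.2 z.2 * χ j.2 z.2) := by ring
    simp_rw [h]
    rw [integral_prod_mul (fun x => φ i.1 x * φ j.1 x) (fun y => χ i.2 y * χ j.2 y),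
      hφ.ortho, hχ.ortho]
    obtain ⟨i₁, i₂⟩ := i
    obtain ⟨j₁, j₂⟩ := j
    simp only [Prod.mk.injEq]
    split_ifs <;> simp_all

variable [Fintype ι] [Fintype κ]

/-- The defect in Bessel's inequality for `f` and the family `φ`. -/
noncomputable def sqDefect (μ : Measure X) (φ : ι → X → ℝ) (f : X → ℝ) : ℝ :=
  ∫ x, f x ^ 2 ∂μ - ∑ i, (∫ x, f x * φ i x ∂μ) ^ 2

lemma sqDefect_const_mul (μ : Measure X) (φ : ι → X → ℝ) (f : X → ℝ) (c : ℝ) :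
    sqDefect μ φ (fun x => c * f x) = c ^ 2 * sqDefect μ φ f := by
  simp_rw [sqDefect, mul_pow, mul_assoc, integral_const_mul, mul_sub, mul_pow, Finset.mul_sum]

variable [DecidableEq ι] [DecidableEq κ]

lemma IsBddOrtho.integral_sub_sq {μ : Measure X} [IsFiniteMeasure μ] {φ : ι → X → ℝ}
    (hφ : IsBddOrtho μ φ) {f : X → ℝ} (hf : IsBddMeas f) (d : ι → ℝ) :
    ∫ x, (f x - ∑ i, d i * φ i x) ^ 2 ∂μ =
      sqDefect μ φ f + ∑ i, (d i - ∫ x, f x * φ i x ∂μ) ^ 2 := by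
  have hdφ i : IsBddMeas fun x => d i * φ i x := (IsBddMeas.const _).mul (hφ.bddMeas i)
  have hS : IsBddMeas fun x => ∑ i, d i * φ i x := IsBddMeas.sum _ hdφ
  have h1 : ∫ x, f x * ∑ i, d i * φ i x ∂μ = ∑ i, d i * ∫ x, f x * φ i x ∂μ := by
    simp_rw [Finset.mul_sum]
    rw [integral_finsetSum _ fun i _ => (hf.mul (hdφ i)).integrable μ]
    refine Finset.sum_congr rfl fun i _ => ?_
    rw [← integral_const_mul]
    congr 1 with x
    ring
  have h2 : ∫ x, (∑ i, d i * φ i x) ^ 2 ∂μ = ∑ i, d i ^ 2 := by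
    simp_rw [pow_two, Finset.sum_mul_sum]
    rw [integral_finsetSum _ fun i _ =>
      (IsBddMeas.sum _ fun j => (hdφ i).mul (hdφ j)).integrable μ]
    refine Finset.sum_congr rfl fun i _ => ?_
    rw [integral_finsetSum _ fun j _ => ((hdφ i).mul (hdφ j)).integrable μ]
    have h j : ∫ x, d i * φ i x * (d j * φ j x) ∂μ = d i * d j * if i = j then 1 else 0 := by
      rw [← hφ.ortho, ← integral_const_mul]
      congr 1 with x
      ring
    simp [h]
  have h3 : ∫ x, (f x - ∑ i, d i * φ i x) ^ 2 ∂μ = ∫ x, f x ^ 2 ∂μ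
      - 2 * ∫ x, f x * ∑ i, d i * φ i x ∂μ + ∫ x, (∑ i, d i * φ i x) ^ 2 ∂μ := by
    rw [← integral_const_mul, ← integral_sub (hf.sq.integrable μ)
      (((IsBddMeas.const 2).mul (hf.mul hS)).integrable μ), ← integral_add
      ((hf.sq.sub ((IsBddMeas.const 2).mul (hf.mul hS))).integrable μ) (hS.sq.integrable μ)]
    congr 1 with x
    ring
  rw [h3, h1, h2, sqDefect, Finset.mul_sum, sub_add, sub_add, ← Finset.sum_sub_distrib,
    ← Finset.sum_sub_distrib]
  congr 1
  refine Finset.sum_congr rfl fun i _ => ?_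
  ring

lemma IsBddOrtho.sqDefect_eq {μ : Measure X} [IsFiniteMeasure μ] {φ : ι → X → ℝ}
    (hφ : IsBddOrtho μ φ) {f : X → ℝ} (hf : IsBddMeas f) :
    sqDefect μ φ f = ∫ x, (f x - ∑ i, (∫ x', f x' * φ i x' ∂μ) * φ i x) ^ 2 ∂μ := by
  rw [hφ.integral_sub_sq hf]
  simp

lemma IsBddOrtho.sqDefect_le {μ : Measure X} [IsFiniteMeasure μ] {φ : ι → X → ℝ}
    (hφ : IsBddOrtho μ φ) {f : X → ℝ} (hf : IsBddMeas f) (d : ι → ℝ) :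
    sqDefect μ φ f ≤ ∫ x, (f x - ∑ i, d i * φ i x) ^ 2 ∂μ := by
  rw [hφ.integral_sub_sq hf]
  exact le_add_of_nonneg_right (Finset.sum_nonneg fun i _ => sq_nonneg _)

lemma IsBddOrtho.sqDefect_nonneg {μ : Measure X} [IsFiniteMeasure μ] {φ : ι → X → ℝ}
    (hφ : IsBddOrtho μ φ) {f : X → ℝ} (hf : IsBddMeas f) : 0 ≤ sqDefect μ φ f := by
  rw [hφ.sqDefect_eq hf]
  exact integral_nonneg fun x => sq_nonneg _

/-- The Bessel defect for a tensor product of orthonormal families is controlled by the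
averaged defects of the two families of slices. -/
lemma IsBddOrtho.sqDefect_prod_le {μ : Measure X} {ν : Measure Y} [IsFiniteMeasure μ]
    [IsFiniteMeasure ν] {φ : ι → X → ℝ} {χ : κ → Y → ℝ} (hφ : IsBddOrtho μ φ)
    (hχ : IsBddOrtho ν χ) {F : X × Y → ℝ} (hF : IsBddMeas F) :
    sqDefect (μ.prod ν) (fun (i : ι × κ) (z : X × Y) => φ i.1 z.1 * χ i.2 z.2) F ≤
      ∫ y, sqDefect μ φ (fun x => F (x, y)) ∂ν + ∫ x, sqDefect ν χ (fun y => F (x, y)) ∂μ := by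
  have hφ1 i : IsBddMeas fun z : X × Y => φ i z.1 := (hφ.bddMeas i).comp measurable_fst
  have hχ2 j : IsBddMeas fun z : X × Y => χ j z.2 := (hχ.bddMeas j).comp measurable_snd
  set a : ι → Y → ℝ := fun i y => ∫ x, F (x, y) * φ i x ∂μ with ha
  set b : κ → X → ℝ := fun j x => ∫ y, F (x, y) * χ j y ∂ν with hb
  have hab i : IsBddMeas (a i) := (hF.mul (hφ1 i)).integral_fst μ
  have hbb j : IsBddMeas (b j) := (hF.mul (hχ2 j)).integral_snd ν
  have hprod {G : X × Y → ℝ} (hG : IsBddMeas G) :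
      ∫ z, G z ∂(μ.prod ν) = ∫ y, ∫ x, G (x, y) ∂μ ∂ν :=
    integral_prod_symm _ (hG.integrable _)
  have hc i j : ∫ z, F z * (φ i z.1 * χ j z.2) ∂(μ.prod ν) = ∫ y, a i y * χ j y ∂ν := by
    rw [hprod (hF.mul ((hφ1 i).mul (hχ2 j)))]
    congr 1 with y
    rw [ha, ← integral_mul_const]
    congr 1 with x
    ring
  have hc' i j : ∫ x, b j x * φ i x ∂μ = ∫ y, a i y * χ j y ∂ν := by
    rw [← hc, integral_prod _ ((hF.mul ((hφ1 i).mul (hχ2 j))).integrable _)]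
    congr 1 with x
    rw [hb, ← integral_mul_const]
    congr 1 with y
    ring
  have hsplit : sqDefect (μ.prod ν) (fun (i : ι × κ) (z : X × Y) => φ i.1 z.1 * χ i.2 z.2) F =
      ∫ y, sqDefect μ φ (fun x => F (x, y)) ∂ν + ∑ i, sqDefect ν χ (a i) := by
    simp only [sqDefect]
    rw [integral_sub (hF.sq.integral_fst μ |>.integrable ν)
      ((IsBddMeas.sum _ fun i => (hab i).sq).integrable ν), hprod hF.sq, Finset.sum_sub_distrib,
      Fintype.sum_prod_type, integral_finsetSum _ fun i _ => (hab i).sq.integrable ν]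
    simp_rw [hc]
    ring
  rw [hsplit]
  gcongr
  set G : X × Y → ℝ := fun z => F z - ∑ j, b j z.1 * χ j z.2 with hG
  have hGb : IsBddMeas G :=
    hF.sub (IsBddMeas.sum _ fun j => ((hbb j).comp measurable_fst).mul (hχ2 j))
  have hGφ i y : ∫ x, G (x, y) * φ i x ∂μ = a i y - ∑ j, (∫ y, a i y * χ j y ∂ν) * χ j y := by
    have h1 j : IsBddMeas fun x => b j x * φ i x * χ j y :=
      ((hbb j).mul (hφ.bddMeas i)).mul (IsBddMeas.const _)
    have h (x : X) : G (x, y) * φ i x = F (x, y) * φ i x - ∑ j, b j x * φ i x * χ j y := by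
      simp only [hG, sub_mul, Finset.sum_mul]
      congr 1
      exact Finset.sum_congr rfl fun j _ => by ring
    simp_rw [h]
    rw [integral_sub ((hF.comp measurable_prodMk_right).mul (hφ.bddMeas i) |>.integrable μ)
      ((IsBddMeas.sum _ h1).integrable μ), integral_finsetSum _ fun j _ => (h1 j).integrable μ]
    simp_rw [integral_mul_const, hc', ha]
  have hR : ∫ x, sqDefect ν χ (fun y => F (x, y)) ∂μ = ∫ y, ∫ x, G (x, y) ^ 2 ∂μ ∂ν := by
    rw [← hprod hGb.sq, integral_prod _ (hGb.sq.integrable _)]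
    congr 1 with x
    exact hχ.sqDefect_eq (hF.comp measurable_prodMk_left)
  have hL : ∑ i, sqDefect ν χ (a i) = ∫ y, ∑ i, (∫ x, G (x, y) * φ i x ∂μ) ^ 2 ∂ν := by
    rw [integral_finsetSum _ fun i _ =>
      ((hGb.mul (hφ1 i)).integral_fst μ).sq.integrable ν]
    refine Finset.sum_congr rfl fun i _ => ?_
    rw [hχ.sqDefect_eq (hab i)]
    simp_rw [hGφ]
  rw [hR, hL]
  refine integral_mono ((IsBddMeas.sum _ fun i =>
      ((hGb.mul (hφ1 i)).integral_fst μ).sq).integrable ν)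
    ((hGb.sq.integral_fst μ).integrable ν) fun y => ?_
  exact sub_nonneg.1 (hφ.sqDefect_nonneg (hGb.comp measurable_prodMk_right))

end SqDefect

section CosineApproximation

open Set Real Polynomial

/-- The normalized cosine system on `[0, π]`. -/
noncomputable def cosSys (n : ℕ) (θ : ℝ) : ℝ :=
  √((if n = 0 then 1 else 2) / π) * cos (n * θ)

lemma integral_cos_mul_cos (m n : ℕ) :
    ∫ θ in Ioc 0 π, cos (m * θ) * cos (n * θ) =
      if m = n then (if n = 0 then π else π / 2) else 0 := by
  have h : ∫ θ in Ioc 0 π, cos (m * θ) * cos (n * θ) =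
      ∫ x, (Chebyshev.T ℝ m).eval x * (Chebyshev.T ℝ n).eval x ∂Chebyshev.measureT := by
    rw [Chebyshev.integral_measureT_eq_integral_cos, intervalIntegral.integral_of_le pi_pos.le]
    simp [Chebyshev.T_real_cos]
  rw [h]
  split_ifs with h1 h2
  · subst h1 h2
    exact Chebyshev.integral_eval_T_real_mul_self_measureT_zero
  · subst h1
    exact Chebyshev.integral_T_real_mul_self_measureT_of_ne_zero h2
  · exact Chebyshev.integral_eval_T_real_mul_eval_T_real_measureT_of_ne h1

lemma isBddMeas_cos (n : ℕ) : IsBddMeas fun θ : ℝ => cos (n * θ) :=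
  ⟨by fun_prop, 1, fun _ => abs_cos_le_one _⟩

lemma isBddOrtho_cosSys (p : ℕ) :
    IsBddOrtho (volume.restrict (Ioc 0 π)) fun n : Fin (p + 1) => cosSys n where
  bddMeas n := (IsBddMeas.const _).mul (isBddMeas_cos n)
  ortho m n := by
    have h (θ : ℝ) : cosSys m θ * cosSys n θ = √((if (m : ℕ) = 0 then 1 else 2) / π) *
        √((if (n : ℕ) = 0 then 1 else 2) / π) * (cos ((m : ℕ) * θ) * cos ((n : ℕ) * θ)) := by
      simp only [cosSys]
      ring
    simp_rw [h]
    rw [integral_const_mul, integral_cos_mul_cos]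
    by_cases h1 : m = n
    · subst h1
      rw [mul_self_sqrt (by positivity)]
      by_cases h2 : (m : ℕ) = 0
      · simp only [h2, if_true]
        field_simp
      · simp only [h2, if_true, if_false]
        field_simp
    · simp only [h1, Fin.val_inj, if_false, mul_zero]

/-- Parseval's identity for cosine series. -/
lemma hasSum_sq_integral_cos {h : ℝ → ℝ} (hh : IsBddMeas h) :
    HasSum (fun n : ℕ => 2 * (∫ θ in Ioc 0 π, h θ * cos (n * θ)) ^ 2)
      (π * (∫ θ in Ioc 0 π, h θ ^ 2) + (∫ θ in Ioc 0 π, h θ) ^ 2) := by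
  have hpi : -π < π := by linarith [pi_pos]
  set g : ℝ → ℂ := fun θ => (h |θ| : ℂ) with hg
  have hgm : IsBddMeas fun θ => h |θ| := hh.comp measurable_norm
  have hg2 : MemLp g 2 (volume.restrict (Ioc (-π) π)) := by
    obtain ⟨A, hA⟩ := hgm.bound
    refine MemLp.of_bound
      (Complex.measurable_ofReal.comp hgm.measurable).aestronglyMeasurable A (ae_of_all _ fun x => ?_)
    simpa [hg] using hA x
  have heven (f : ℝ → ℝ) (hf : IsBddMeas f) :
      ∫ θ in (-π)..π, f |θ| = 2 * ∫ θ in Ioc 0 π, f θ := by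
    have hint (a b : ℝ) : IntervalIntegrable (fun θ => f |θ|) volume a b :=
      ⟨(hf.comp measurable_norm).integrable _, (hf.comp measurable_norm).integrable _⟩
    rw [← intervalIntegral.integral_of_le pi_pos.le,
      ← intervalIntegral.integral_add_adjacent_intervals (hint (-π) 0) (hint 0 π)]
    have h0 : ∫ θ in (0 : ℝ)..π, f |θ| = ∫ θ in (0 : ℝ)..π, f θ := by
      refine intervalIntegral.integral_congr fun θ hθ => ?_
      rw [uIcc_of_le pi_pos.le] at hθ
      simp [abs_of_nonneg hθ.1]
    have h1 : ∫ θ in (-π)..0, f |θ| = ∫ θ in (0 : ℝ)..π, f |θ| := by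
      simpa using! (intervalIntegral.integral_comp_neg (a := 0) (b := π) fun θ => f |θ|).symm
    rw [h1, h0]
    ring
  have hcoef (n : ℤ) : ‖fourierCoeffOn hpi g n‖ ^ 2 =
      (∫ θ in Ioc 0 π, h θ * cos (n * θ)) ^ 2 / π ^ 2 := by
    have hsin : ∫ θ in (-π)..π, h |θ| * sin (n * θ) = 0 := by
      have := intervalIntegral.integral_comp_neg (a := -π) (b := π)
        fun θ => h |θ| * sin (n * θ)
      simp only [abs_neg, mul_neg, sin_neg, intervalIntegral.integral_neg, neg_neg] at this
      linarith
    have hcos : ∫ θ in (-π)..π, h |θ| * cos (n * θ) =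
        2 * ∫ θ in Ioc 0 π, h θ * cos (n * θ) := by
      rw [← heven _ (hh.mul ⟨by fun_prop, 1, fun _ => abs_cos_le_one _⟩)]
      congr 1 with θ
      rcases abs_choice θ with h | h <;> simp [h]
    have hfour : ∫ θ in (-π)..π, fourier (-n) (θ : AddCircle (π - -π)) • g θ =
        ((∫ θ in (-π)..π, h |θ| * cos (n * θ) : ℝ) : ℂ) -
          ((∫ θ in (-π)..π, h |θ| * sin (n * θ) : ℝ) : ℂ) * Complex.I := by
      rw [← intervalIntegral.integral_ofReal, ← intervalIntegral.integral_ofReal,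
        ← intervalIntegral.integral_mul_const, ← intervalIntegral.integral_sub]
      · congr 1 with θ
        rw [fourier_coe_apply, smul_eq_mul]
        have : 2 * π * Complex.I * ((-n : ℤ) : ℂ) * (θ : ℂ) / ((π - -π : ℝ) : ℂ) =
            ((-(n * θ) : ℝ) : ℂ) * Complex.I := by
          have := pi_ne_zero
          push_cast
          field_simp
          ring
        rw [this, Complex.exp_mul_I, ← Complex.ofReal_cos, ← Complex.ofReal_sin, cos_neg, sin_neg]
        simp only [hg]
        push_cast
        ring
      · have := (hgm.mul (g := fun θ => cos (n * θ)) ⟨by fun_prop, 1, fun _ => abs_cos_le_one _⟩)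
        exact ⟨(this.integrable _).ofReal, (this.integrable _).ofReal⟩
      · have := (hgm.mul (g := fun θ => sin (n * θ)) ⟨by fun_prop, 1, fun _ => abs_sin_le_one _⟩)
        exact ⟨(this.integrable _).ofReal.mul_const _, (this.integrable _).ofReal.mul_const _⟩
    rw [fourierCoeffOn_eq_integral, hfour, hsin, hcos]
    simp only [Complex.ofReal_zero, zero_mul, sub_zero, norm_smul, Complex.norm_real, mul_pow,
      norm_eq_abs, sq_abs]
    field_simp
    ring
  have key := hasSum_sq_fourierCoeffOn hpi hg2
  simp_rw [hcoef] at key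
  have key2 := (key.nat_add_neg).mul_left (π ^ 2)
  convert! key2 using 1
  · ext n
    have : π ^ 2 ≠ 0 := by positivity
    simp only [Int.cast_natCast, Int.cast_neg, neg_mul, cos_neg]
    field_simp
    ring
  · have h2 : ∫ θ in (-π)..π, ‖g θ‖ ^ 2 = 2 * ∫ θ in Ioc 0 π, h θ ^ 2 := by
      rw [← heven _ hh.sq]
      simp [hg]
    rw [h2]
    simp only [smul_eq_mul, Int.cast_zero, zero_mul, cos_zero, mul_one]
    field_simp
    ring

lemma sqDefect_cosSys_le {h : ℝ → ℝ} (hh : IsBddMeas h) {B : ℝ}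
    (hB : ∀ n : ℕ, n ≠ 0 → |∫ θ in Ioc 0 π, h θ * cos (n * θ)| ≤ B / n) {p : ℕ} (hp : 1 ≤ p) :
    sqDefect (volume.restrict (Ioc 0 π)) (fun n : Fin (p + 1) => cosSys n) h ≤
      (2 / π * B ^ 2) / p := by
  set a : ℕ → ℝ := fun n => ∫ θ in Ioc 0 π, h θ * cos (n * θ) with ha
  have hc (n : ℕ) : (∫ θ in Ioc 0 π, h θ * cosSys n θ) ^ 2 =
      (if n = 0 then 1 else 2) / π * a n ^ 2 := by
    have h1 : ∫ θ in Ioc 0 π, h θ * cosSys n θ = √((if n = 0 then 1 else 2) / π) * a n := by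
      rw [ha, ← integral_const_mul]
      congr 1 with θ
      simp only [cosSys]
      ring
    rw [h1, mul_pow, sq_sqrt (by positivity)]
  have hsum : ∑ n : Fin (p + 1), (∫ θ in Ioc 0 π, h θ * cosSys n θ) ^ 2 =
      (∑ n ∈ Finset.range (p + 1), 2 * a n ^ 2 - a 0 ^ 2) / π := by
    rw [Fin.sum_univ_eq_sum_range fun n => (∫ θ in Ioc 0 π, h θ * cosSys n θ) ^ 2]
    simp_rw [hc, Finset.sum_range_succ' _ p]
    simp only [Nat.add_eq_zero_iff, one_ne_zero, and_false, if_false, if_true, add_sub_assoc,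
      add_div, Finset.sum_div]
    congr 1
    · exact Finset.sum_congr rfl fun n _ => by ring
    · ring
  have hlim := (hasSum_sq_integral_cos hh).tendsto_sum_nat
  have hle : π * (∫ θ in Ioc 0 π, h θ ^ 2) + (∫ θ in Ioc 0 π, h θ) ^ 2 ≤
      ∑ n ∈ Finset.range (p + 1), 2 * a n ^ 2 + 2 * B ^ 2 / p := by
    refine le_of_tendsto hlim (Filter.eventually_atTop.2 ⟨p + 1, fun N hN => ?_⟩)
    have hp0 : p ≠ 0 := by omega
    obtain ⟨M, rfl⟩ : ∃ M, N = M + 1 := ⟨N - 1, by omega⟩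
    have hpM : p ≤ M := by omega
    rw [← Finset.sum_range_add_sum_Ico _ hN]
    gcongr
    have hIoc : Finset.Ico (p + 1) (M + 1) = Finset.Ioc p M := by
      ext
      simp only [Finset.mem_Ico, Finset.mem_Ioc]
      omega
    rw [hIoc]
    calc ∑ n ∈ Finset.Ioc p M, 2 * (∫ θ in Ioc 0 π, h θ * cos (n * θ)) ^ 2
        ≤ ∑ n ∈ Finset.Ioc p M, 2 * B ^ 2 * ((n : ℝ) ^ 2)⁻¹ := by
          refine Finset.sum_le_sum fun n hn => ?_
          have hn0 : n ≠ 0 := by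
            have := (Finset.mem_Ioc.1 hn).1
            omega
          have := sq_le_sq' (abs_le.1 (hB n hn0)).1 (abs_le.1 (hB n hn0)).2
          rw [div_pow] at this
          calc _ ≤ 2 * (B ^ 2 / (n : ℝ) ^ 2) := by gcongr
            _ = _ := by ring
      _ ≤ 2 * B ^ 2 * ((p : ℝ)⁻¹ - (M : ℝ)⁻¹) := by
          rw [← Finset.mul_sum]
          gcongr
          exact sum_Ioc_inv_sq_le_sub hp0 hpM
      _ ≤ 2 * B ^ 2 * (p : ℝ)⁻¹ := by
          gcongr
          simp
      _ = _ := by ring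
  have ha0 : a 0 = ∫ θ in Ioc 0 π, h θ := by simp [ha]
  rw [sqDefect, hsum, ha0]
  rw [show (2 / π * B ^ 2) / p = (2 * B ^ 2 / p) / π by ring, sub_le_iff_le_add, ← add_div,
    le_div_iff₀ pi_pos]
  linarith

lemma abs_integral_mul_cos_le {u u' : ℝ → ℝ} (hu : ∀ x, HasDerivAt u (u' x) x)
    (hu' : Continuous u') {M M' : ℝ} (hM : ∀ x ∈ Icc 0 π, |u x| ≤ M)
    (hM' : ∀ x ∈ Icc 0 π, |u' x| ≤ M') {α β : ℝ} (hα : 0 ≤ α) (hαβ : α ≤ β) (hβ : β ≤ π)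
    {n : ℕ} (hn : n ≠ 0) :
    |∫ θ in α..β, u θ * cos (n * θ)| ≤ (2 * M + π * M') / n := by
  have hn' : (0 : ℝ) < n := by positivity
  have hv (x : ℝ) : HasDerivAt (fun θ => sin (n * θ) / n) (cos (n * x)) x := by
    have := ((hasDerivAt_id x).const_mul (n : ℝ)).sin.div_const (n : ℝ)
    convert! this using 1
    simp
    field_simp
  rw [intervalIntegral.integral_mul_deriv_eq_deriv_mul (fun x _ => hu x) (fun x _ => hv x)
    (hu'.intervalIntegrable _ _) ((by fun_prop : Continuous _).intervalIntegrable _ _)]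
  have hs (x : ℝ) : |sin (n * x) / n| ≤ 1 / n := by
    rw [abs_div, Nat.abs_cast]
    gcongr
    exact abs_sin_le_one _
  have hbd {x : ℝ} (hx : x ∈ Icc 0 π) : |u x * (sin (n * x) / n)| ≤ M * (1 / n) := by
    rw [abs_mul]
    exact mul_le_mul (hM x hx) (hs x) (abs_nonneg _) ((abs_nonneg _).trans (hM x hx))
  have hM'0 : 0 ≤ M' := (abs_nonneg _).trans (hM' 0 ⟨le_rfl, pi_pos.le⟩)
  have hI : |∫ x in α..β, u' x * (sin (n * x) / n)| ≤ M' * (1 / n) * |β - α| := by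
    refine intervalIntegral.norm_integral_le_of_norm_le_const
      (f := fun x => u' x * (sin (n * x) / n)) fun x hx => ?_
    rw [uIoc_of_le hαβ] at hx
    rw [norm_eq_abs, abs_mul]
    exact mul_le_mul (hM' x ⟨by linarith [hx.1], by linarith [hx.2]⟩) (hs x) (abs_nonneg _) hM'0
  have hlen : M' * (1 / n) * |β - α| ≤ M' * (1 / n) * π := by
    gcongr
    rw [abs_of_nonneg (by linarith)]
    linarith
  have hα' := hbd ⟨hα, hαβ.trans hβ⟩
  have hβ' := hbd ⟨hα.trans hαβ, hβ⟩
  calc _ ≤ M * (1 / n) + M * (1 / n) + M' * (1 / n) * π := by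
        refine (abs_sub _ _).trans (add_le_add ((abs_sub _ _).trans ?_) (hI.trans hlen))
        exact add_le_add hβ' hα'
    _ = _ := by ring

lemma lt_cos_iff_lt_arccos {A θ : ℝ} (hθ : θ ∈ Ioo 0 π) : A < cos θ ↔ θ < arccos A := by
  rw [← not_le, ← not_le, not_iff_not]
  nth_rw 2 [← arccos_cos hθ.1.le hθ.2.le]
  refine ⟨fun h => antitone_arccos h, fun h => ?_⟩
  by_contra! hlt
  rw [arccos_cos hθ.1.le hθ.2.le] at h
  rcases le_or_gt (-1) A with hA | hA
  · have := strictAntiOn_arccos ⟨hA, hlt.le.trans (cos_le_one _)⟩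
      ⟨neg_one_le_cos _, cos_le_one _⟩ hlt
    rw [arccos_cos hθ.1.le hθ.2.le] at this
    linarith
  · rw [arccos_of_le_neg_one hA.le] at h
    linarith [hθ.2]

lemma cos_lt_iff_arccos_lt {A θ : ℝ} (hθ : θ ∈ Ioo 0 π) : cos θ < A ↔ arccos A < θ := by
  have h := lt_cos_iff_lt_arccos (A := -A) (θ := π - θ) ⟨by linarith [hθ.2], by linarith [hθ.1]⟩
  rw [cos_pi_sub, arccos_neg, neg_lt_neg_iff] at h
  rw [h]
  constructor <;> intro h <;> linarith

end CosineApproximation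

section PolynomialApproximation

open Set Real Polynomial

lemma exists_hasDerivAt_eqOn_Icc {t T : ℝ} (ht : t < T) {ψ : ℝ → ℝ}
    (hψ : ContDiffOn ℝ 1 ψ (Icc t T)) :
    ∃ Ψ D : ℝ → ℝ, (∀ x, HasDerivAt Ψ (D x) x) ∧ Continuous D ∧ EqOn ψ Ψ (Icc t T) := by
  have hd : ContinuousOn (derivWithin ψ (Icc t T)) (Icc t T) :=
    hψ.continuousOn_derivWithin (uniqueDiffOn_Icc ht) le_rfl
  set D : ℝ → ℝ := IccExtend ht.le ((Icc t T).domRestrict (derivWithin ψ (Icc t T))) with hD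
  have hDc : Continuous D := hd.domRestrict.Icc_extend'
  refine ⟨fun x => ψ t + ∫ s in t..x, D s, D,
    fun x => (hDc.integral_hasStrictDerivAt t x).hasDerivAt.const_add _, hDc, fun x hx => ?_⟩
  have h := intervalIntegral.integral_eq_sub_of_hasDerivAt_of_le (f := ψ) (f' := D) hx.1
    (hψ.continuousOn.mono (Icc_subset_Icc_right hx.2)) (fun y hy => ?_)
    (hDc.intervalIntegrable _ _)
  · simp [h]
  · have hy' : y ∈ Ioo t T := ⟨hy.1, hy.2.trans_le hx.2⟩
    have hyc := Ioo_subset_Icc_self hy'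
    have h1 := ((hψ.differentiableOn one_ne_zero) y hyc).hasDerivWithinAt.hasDerivAt
      (Icc_mem_nhds hy'.1 hy'.2)
    convert! h1 using 1
    rw [hD, IccExtend_of_mem _ _ hyc]
    rfl

/-- Integrals over `[m - r, m + r]` in the variable `m + r cos θ`. -/
lemma setIntegral_Icc_eq_integral_cos {m r : ℝ} (hr : 0 < r) (f : ℝ → ℝ) :
    ∫ x in Icc (m - r) (m + r), f x = ∫ θ in Ioc 0 π, |-(r * sin θ)| * f (m + r * cos θ) := by
  have himg : (fun θ => m + r * cos θ) '' Icc 0 π = Icc (m - r) (m + r) := by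
    ext x
    constructor
    · rintro ⟨θ, -, rfl⟩
      constructor <;> nlinarith [neg_one_le_cos θ, cos_le_one θ]
    · rintro ⟨h1, h2⟩
      refine ⟨arccos ((x - m) / r), ⟨arccos_nonneg _, arccos_le_pi _⟩, ?_⟩
      have h3 : -1 ≤ (x - m) / r := by
        rw [le_div_iff₀ hr]
        linarith
      have h4 : (x - m) / r ≤ 1 := by
        rw [div_le_iff₀ hr]
        linarith
      simp only [cos_arccos h3 h4]
      field_simp
      ring
  have hinj : InjOn (fun θ => m + r * cos θ) (Icc 0 π) := fun x hx y hy h =>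
    injOn_cos hx hy (mul_left_cancel₀ hr.ne' (add_left_cancel h))
  rw [← himg, integral_image_eq_integral_abs_deriv_smul (f' := fun θ => -(r * sin θ))
    measurableSet_Icc (fun x _ => ?_) hinj, integral_Icc_eq_integral_Ioc]
  · rfl
  · refine HasDerivAt.hasDerivWithinAt ?_
    convert! ((hasDerivAt_cos x).const_mul r).const_add m using 1
    ring

/-- Truncations of a `C¹` function are approximated by polynomials of degree at most `p` in
`L²` with squared error `O(1/p)`, uniformly in the truncation. -/
lemma exists_polynomial_approx_indicator {t T : ℝ} (ht : t < T) {ψ : ℝ → ℝ}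
    (hψ : ContDiffOn ℝ 1 ψ (Icc t T)) :
    ∃ C : ℝ, 0 ≤ C ∧ ∀ p : ℕ, 1 ≤ p → ∀ a b : ℝ, ∃ Q : ℝ[X], Q.natDegree ≤ p ∧
      ∫ x in Icc t T, ((Ioo a b).indicator ψ x - Q.eval x) ^ 2 ≤ C / p := by
  obtain ⟨Ψ, D, hΨ, hD, heq⟩ := exists_hasDerivAt_eqOn_Icc ht hψ
  have hΨc : Continuous Ψ := continuous_iff_continuousAt.2 fun x => (hΨ x).continuousAt
  obtain ⟨M, hM⟩ := isCompact_Icc.exists_bound_of_continuousOn (s := Icc t T) hΨc.continuousOn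
  obtain ⟨M', hM'⟩ := isCompact_Icc.exists_bound_of_continuousOn (s := Icc t T) hD.continuousOn
  obtain ⟨m, r, hr, rfl, rfl⟩ : ∃ m r : ℝ, 0 < r ∧ t = m - r ∧ T = m + r :=
    ⟨(t + T) / 2, (T - t) / 2, by linarith, by ring, by ring⟩
  have hγ (θ : ℝ) : m + r * cos θ ∈ Icc (m - r) (m + r) := by
    constructor <;> nlinarith [neg_one_le_cos θ, cos_le_one θ]
  set u : ℝ → ℝ := fun θ => Ψ (m + r * cos θ) with hu
  set u' : ℝ → ℝ := fun θ => D (m + r * cos θ) * (r * -sin θ) with hu'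
  have huu' (θ : ℝ) : HasDerivAt u (u' θ) θ :=
    (hΨ _).comp θ (((hasDerivAt_cos θ).const_mul r).const_add m)
  have hu'c : Continuous u' := by
    simp only [hu']
    fun_prop
  have huM (θ : ℝ) : |u θ| ≤ M := hM _ (hγ θ)
  have hM'0 : 0 ≤ M' := (norm_nonneg _).trans (hM' _ (hγ 0))
  have hM0 : 0 ≤ M := (norm_nonneg _).trans (hM _ (hγ 0))
  have hu'M (θ : ℝ) : |u' θ| ≤ M' * r := by
    simp only [hu', abs_mul, abs_neg, abs_of_pos hr]
    refine mul_le_mul (hM' _ (hγ θ)) ?_ (by positivity) hM'0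
    exact mul_le_of_le_one_right hr.le (abs_sin_le_one _)
  set B := 2 * M + π * (M' * r) with hB
  refine ⟨r * (2 / π * B ^ 2), by positivity, fun p hp a b => ?_⟩
  set h : ℝ → ℝ := fun θ => {θ | m + r * cos θ ∈ Ioo a b}.indicator u θ with hh
  have hmeas : MeasurableSet {θ | m + r * cos θ ∈ Ioo a b} :=
    (by fun_prop : Measurable fun θ => m + r * cos θ) measurableSet_Ioo
  have hhb : IsBddMeas h := by
    refine ⟨Measurable.indicator (by fun_prop) hmeas, M, fun θ => ?_⟩
    by_cases hθ : θ ∈ {θ | m + r * cos θ ∈ Ioo a b}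
    · rw [show h θ = u θ from indicator_of_mem hθ _]
      exact huM θ
    · rw [show h θ = 0 from indicator_of_notMem hθ _, abs_zero]
      exact hM0
  have hcoef (n : ℕ) (hn : n ≠ 0) : |∫ θ in Ioc 0 π, h θ * cos (n * θ)| ≤ B / n := by
    set α := arccos ((b - m) / r) with hα
    set β := arccos ((a - m) / r) with hβ
    have hset (θ : ℝ) (hθ : θ ∈ Ioo 0 π) : m + r * cos θ ∈ Ioo a b ↔ θ ∈ Ioo α β := by
      rw [mem_Ioo, mem_Ioo, hα, hβ, ← cos_lt_iff_arccos_lt hθ, ← lt_cos_iff_lt_arccos hθ,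
        div_lt_iff₀ hr, lt_div_iff₀ hr, and_comm]
      constructor <;> rintro ⟨h1, h2⟩ <;> constructor <;> linarith
    have hsub : Ioo α β ⊆ Ioo 0 π :=
      Ioo_subset_Ioo (arccos_nonneg _) (arccos_le_pi _)
    have hint : ∫ θ in Ioc 0 π, h θ * cos (n * θ) = ∫ θ in Ioo α β, u θ * cos (n * θ) := by
      rw [integral_Ioc_eq_integral_Ioo, ← inter_eq_self_of_subset_right hsub,
        ← setIntegral_indicator measurableSet_Ioo]
      refine setIntegral_congr_fun measurableSet_Ioo fun θ hθ => ?_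
      by_cases hθ' : θ ∈ Ioo α β
      · have := (hset θ hθ).2 hθ'
        simp only [hh, indicator, mem_ofPred_eq, this, hθ', if_true]
      · have := (hset θ hθ).not.2 hθ'
        simp only [hh, indicator, mem_ofPred_eq, this, hθ', if_false, zero_mul]
    rw [hint]
    rcases le_or_gt α β with hle | hlt
    · rw [← integral_Ioc_eq_integral_Ioo, ← intervalIntegral.integral_of_le hle]
      exact abs_integral_mul_cos_le huu' hu'c (fun x _ => huM x) (fun x _ => hu'M x)
        (arccos_nonneg _) hle (arccos_le_pi _) hn
    · rw [Ioo_eq_empty (not_lt.2 hlt.le)]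
      simp only [Measure.restrict_empty, integral_zero_measure, abs_zero]
      positivity
  set d : Fin (p + 1) → ℝ := fun n => ∫ θ in Ioc 0 π, h θ * cosSys n θ with hd
  set Q : ℝ[X] := ∑ n : Fin (p + 1), Polynomial.C (d n * √((if (n : ℕ) = 0 then 1 else 2) / π)) *
    (Chebyshev.T ℝ n).comp (Polynomial.C r⁻¹ * (X - Polynomial.C m)) with hQ
  have hQeval (θ : ℝ) : Q.eval (m + r * cos θ) = ∑ n, d n * cosSys n θ := by
    simp only [hQ, eval_finsetSum, eval_mul, eval_C, eval_comp, eval_sub, eval_X,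
      add_sub_cancel_left, inv_mul_cancel_left₀ hr.ne', Chebyshev.T_real_cos, cosSys, mul_assoc,
      Int.cast_natCast]
  refine ⟨Q, natDegree_sum_le_of_forall_le _ _ fun n _ => ?_, ?_⟩
  · refine (natDegree_C_mul_le _ _).trans (natDegree_comp_le.trans ?_)
    have h1 : (Chebyshev.T ℝ n).natDegree = n := by simp [Chebyshev.natDegree_T]
    have h2 : (Polynomial.C r⁻¹ * (X - Polynomial.C m)).natDegree ≤ 1 :=
      (natDegree_C_mul_le _ _).trans (natDegree_X_sub_C m).le
    rw [h1]
    have := n.2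
    nlinarith
  rw [setIntegral_Icc_eq_integral_cos hr]
  have hS : IsBddMeas fun θ => ∑ n, d n * cosSys n θ :=
    IsBddMeas.sum _ fun n => (IsBddMeas.const _).mul ((isBddOrtho_cosSys p).bddMeas n)
  calc ∫ θ in Ioc 0 π, |-(r * sin θ)| *
        ((Ioo a b).indicator ψ (m + r * cos θ) - Q.eval (m + r * cos θ)) ^ 2
      = ∫ θ in Ioc 0 π, |-(r * sin θ)| * (h θ - ∑ n, d n * cosSys n θ) ^ 2 := by
        congr 1 with θ
        rw [hQeval]
        simp only [hh, indicator, hu, heq (hγ θ), mem_ofPred_eq]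
    _ ≤ ∫ θ in Ioc 0 π, r * (h θ - ∑ n, d n * cosSys n θ) ^ 2 := by
        have hs : IsBddMeas fun θ => |-(r * sin θ)| := by
          refine ⟨by fun_prop, r, fun θ => ?_⟩
          rw [abs_abs, abs_neg, abs_mul, abs_of_pos hr]
          exact mul_le_of_le_one_right hr.le (abs_sin_le_one _)
        refine integral_mono ((hs.mul (hhb.sub hS).sq).integrable _)
          (((IsBddMeas.const r).mul (hhb.sub hS).sq).integrable _) fun θ => ?_
        dsimp only
        gcongr
        rw [abs_neg, abs_mul, abs_of_pos hr]
        exact mul_le_of_le_one_right hr.le (abs_sin_le_one _)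
    _ = r * sqDefect (volume.restrict (Ioc 0 π)) (fun n : Fin (p + 1) => cosSys n) h := by
        rw [integral_const_mul, (isBddOrtho_cosSys p).sqDefect_eq hhb]
    _ ≤ r * ((2 / π * B ^ 2) / p) := by
        gcongr
        exact sqDefect_cosSys_le hhb hcoef hp
    _ = _ := by ring

end PolynomialApproximation

section Legendre

open Polynomial

/-- The polynomial `(X² - 1)ⁿ`. -/
noncomputable def rodriguesBase (n : ℕ) : ℝ[X] := (X ^ 2 - C 1) ^ n

/-- The `n`-th Legendre polynomial as an element of `ℝ[X]`. -/
noncomputable def legendrePoly (n : ℕ) : ℝ[X] :=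
  C (1 / (2 ^ n * (Nat.factorial n) : ℝ)) * derivative^[n] (rodriguesBase n)

lemma natDegree_rodriguesBase (n : ℕ) : (rodriguesBase n).natDegree = n * 2 := by
  rw [rodriguesBase, natDegree_pow, natDegree_X_pow_sub_C]

lemma coeff_rodriguesBase (n : ℕ) : (rodriguesBase n).coeff (n + n) = 1 := by
  have h := ((monic_X_pow_sub_C (1 : ℝ) two_ne_zero).pow n).coeff_natDegree
  rwa [← rodriguesBase, natDegree_rodriguesBase, mul_two] at h

lemma coeff_rodriguesBase_of_lt {n m : ℕ} (h : n + n < m) : (rodriguesBase n).coeff m = 0 :=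
  coeff_eq_zero_of_natDegree_lt (by rw [natDegree_rodriguesBase]; omega)

lemma iteratedDeriv_polynomial_eval (n : ℕ) (P : ℝ[X]) :
    iteratedDeriv n (fun x => P.eval x) = fun x => (derivative^[n] P).eval x := by
  induction n with
  | zero => simp
  | succ n ih =>
    rw [iteratedDeriv_succ, ih, Function.iterate_succ_apply']
    ext x
    exact Polynomial.deriv _

lemma legendreP_eq_eval (n : ℕ) (x : ℝ) : legendreP n x = (legendrePoly n).eval x := by
  have h : (fun y : ℝ => (y ^ 2 - 1) ^ n) = fun y => (rodriguesBase n).eval y := by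
    ext y
    simp [rodriguesBase]
  rw [legendreP, h, iteratedDeriv_polynomial_eval, legendrePoly, eval_mul, eval_C]

lemma degree_legendrePoly (n : ℕ) : (legendrePoly n).degree = n := by
  rw [legendrePoly, degree_C_mul (by positivity)]
  refine le_antisymm ?_ (le_degree_of_ne_zero ?_)
  · rw [degree_le_iff_coeff_zero]
    intro m hm
    rw [coeff_iterate_derivative, coeff_rodriguesBase_of_lt (by simpa using hm), smul_zero]
  · rw [coeff_iterate_derivative, coeff_rodriguesBase, nsmul_one, Nat.cast_ne_zero]
    exact mt Nat.descFactorial_eq_zero_iff_lt.1 (by omega)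

lemma iterate_derivative_rodriguesBase_top (n : ℕ) :
    derivative^[n + n] (rodriguesBase n) = C ((n + n).factorial : ℝ) := by
  ext m
  rw [coeff_iterate_derivative, coeff_C]
  rcases Nat.eq_zero_or_pos m with rfl | hm
  · rw [zero_add, coeff_rodriguesBase, Nat.descFactorial_self, nsmul_one, if_pos rfl]
  · rw [coeff_rodriguesBase_of_lt (by omega), smul_zero, if_neg hm.ne']

lemma eval_iterate_derivative_rodriguesBase {n k : ℕ} (hk : k < n) {x : ℝ} (hx : x ^ 2 = 1) :
    (derivative^[k] (rodriguesBase n)).eval x = 0 := by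
  obtain ⟨q, hq⟩ := pow_sub_dvd_iterate_derivative_pow (X ^ 2 - C (1 : ℝ)) n k
  rw [rodriguesBase, hq, eval_mul]
  simp [hx, (Nat.sub_pos_of_lt hk).ne']

lemma integral_eval_derivative_mul {P q : ℝ[X]} (h1 : P.eval 1 = 0) (h2 : P.eval (-1) = 0) :
    ∫ x in (-1 : ℝ)..1, (derivative P).eval x * q.eval x =
      -∫ x in (-1 : ℝ)..1, P.eval x * (derivative q).eval x := by
  rw [intervalIntegral.integral_mul_deriv_eq_deriv_mul (fun x _ => P.hasDerivAt x)
    (fun x _ => q.hasDerivAt x) ((derivative P).continuous.intervalIntegrable _ _)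
    ((derivative q).continuous.intervalIntegrable _ _)]
  simp [h1, h2]

lemma integral_iterate_derivative_rodriguesBase_mul (n : ℕ) (q : ℝ[X]) {k : ℕ} (hk : k ≤ n) :
    ∫ x in (-1 : ℝ)..1, (derivative^[n] (rodriguesBase n)).eval x * q.eval x = (-1) ^ k *
      ∫ x in (-1 : ℝ)..1, (derivative^[n - k] (rodriguesBase n)).eval x *
        (derivative^[k] q).eval x := by
  induction k with
  | zero => simp
  | succ k ih =>
    rw [ih (by omega), show n - k = (n - (k + 1)) + 1 by omega, Function.iterate_succ_apply',
      integral_eval_derivative_mul (eval_iterate_derivative_rodriguesBase (by omega) (by norm_num))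
        (eval_iterate_derivative_rodriguesBase (by omega) (by norm_num)),
      Function.iterate_succ_apply', pow_succ]
    ring

lemma integral_legendrePoly_mul_of_degree_lt {n : ℕ} {q : ℝ[X]} (hq : q.degree < n) :
    ∫ x in (-1 : ℝ)..1, (legendrePoly n).eval x * q.eval x = 0 := by
  simp_rw [legendrePoly, eval_mul, mul_assoc]
  simp only [eval_C]
  rw [intervalIntegral.integral_const_mul,
    integral_iterate_derivative_rodriguesBase_mul n q le_rfl,
    iterate_derivative_eq_zero_of_degree_lt hq]
  simp

lemma integral_one_sub_sq_pow (n : ℕ) :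
    ∫ x in (-1 : ℝ)..1, (1 - x ^ 2) ^ n =
      (2 * (2 ^ n * n.factorial) ^ 2 / ((n + n).factorial * (2 * n + 1)) : ℝ) := by
  induction n with
  | zero => norm_num
  | succ n ih =>
    have hd (x : ℝ) : HasDerivAt (fun x : ℝ => x * (1 - x ^ 2) ^ (n + 1))
        ((2 * n + 3) * (1 - x ^ 2) ^ (n + 1) - (2 * n + 2) * (1 - x ^ 2) ^ n) x := by
      have h := (hasDerivAt_id x).mul ((((hasDerivAt_id x).pow 2).const_sub 1).pow (n + 1))
      convert! h using 1
      simp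
      ring
    have h := intervalIntegral.integral_eq_sub_of_hasDerivAt (a := -1) (b := 1)
      (fun x _ => hd x) ((by fun_prop : Continuous _).intervalIntegrable _ _)
    rw [intervalIntegral.integral_sub ((by fun_prop : Continuous _).intervalIntegrable _ _)
      ((by fun_prop : Continuous _).intervalIntegrable _ _), intervalIntegral.integral_const_mul,
      intervalIntegral.integral_const_mul, ih] at h
    norm_num at h
    have h2 : ∫ x in (-1 : ℝ)..1, (1 - x ^ 2) ^ (n + 1) = ((2 * n + 2) *
        (2 * (2 ^ n * n.factorial) ^ 2 / ((n + n).factorial * (2 * n + 1))) / (2 * n + 3) : ℝ) := by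
      rw [eq_div_iff (by positivity)]
      linarith
    rw [h2, show n + 1 + (n + 1) = (n + n) + 1 + 1 by ring, Nat.factorial_succ, Nat.factorial_succ,
      Nat.factorial_succ]
    push_cast
    have : ((n + n).factorial : ℝ) ≠ 0 := by positivity
    field_simp
    ring

lemma integral_legendrePoly_sq (n : ℕ) :
    ∫ x in (-1 : ℝ)..1, (legendrePoly n).eval x * (legendrePoly n).eval x = 2 / (2 * n + 1) := by
  have h : ∫ x in (-1 : ℝ)..1, (derivative^[n] (rodriguesBase n)).eval x *
      (derivative^[n] (rodriguesBase n)).eval x =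
      (n + n).factorial * ∫ x in (-1 : ℝ)..1, (1 - x ^ 2) ^ n := by
    rw [integral_iterate_derivative_rodriguesBase_mul n _ le_rfl, ← Function.iterate_add_apply,
      iterate_derivative_rodriguesBase_top, ← intervalIntegral.integral_const_mul,
      ← intervalIntegral.integral_const_mul]
    congr 1 with x
    simp only [Nat.sub_self, Function.iterate_zero, id, rodriguesBase, eval_pow, eval_sub, eval_X,
      eval_C]
    rw [show x ^ 2 - 1 = (-1) * (1 - x ^ 2) by ring, mul_pow, mul_right_comm, ← mul_assoc,
      ← mul_assoc, ← mul_pow]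
    simp [mul_comm]
  have h' (x : ℝ) : (legendrePoly n).eval x * (legendrePoly n).eval x =
      (1 / (2 ^ n * (Nat.factorial n) : ℝ)) ^ 2 * ((derivative^[n] (rodriguesBase n)).eval x *
      (derivative^[n] (rodriguesBase n)).eval x) := by
    rw [legendrePoly, eval_mul, eval_C]
    ring
  simp_rw [h']
  rw [intervalIntegral.integral_const_mul, h, integral_one_sub_sq_pow]
  have : ((n + n).factorial : ℝ) ≠ 0 := by positivity
  field_simp

lemma integral_legendrePoly_mul (m n : ℕ) :
    ∫ x in (-1 : ℝ)..1, (legendrePoly m).eval x * (legendrePoly n).eval x =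
      if m = n then 2 / (2 * n + 1 : ℝ) else 0 := by
  split_ifs with h
  · rw [h, integral_legendrePoly_sq]
  · rcases lt_or_gt_of_ne h with h | h
    · simp_rw [mul_comm ((legendrePoly m).eval _)]
      exact integral_legendrePoly_mul_of_degree_lt (by rw [degree_legendrePoly]; exact_mod_cast h)
    · exact integral_legendrePoly_mul_of_degree_lt (by rw [degree_legendrePoly]; exact_mod_cast h)

lemma integral_legendreSys_mul {t T : ℝ} (ht : t < T) (i j : ℕ) :
    ∫ x in t..T, legendreSys t T i x * legendreSys t T j x = if i = j then 1 else 0 := by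
  have hT : 0 < T - t := sub_pos.2 ht
  have h (x : ℝ) : legendreSys t T i x * legendreSys t T j x =
      √((2 * i + 1) / (T - t)) * √((2 * j + 1) / (T - t)) *
      (fun y => (legendrePoly i).eval y * (legendrePoly j).eval y)
        (2 / (T - t) * x - (T + t) / (T - t)) := by
    have : 2 / (T - t) * x - (T + t) / (T - t) = (2 * x - (T + t)) / (T - t) := by ring
    simp only [legendreSys, legendreP_eq_eval, this]
    ring
  simp_rw [h]
  rw [intervalIntegral.integral_const_mul, intervalIntegral.integral_comp_mul_sub
    (fun y => (legendrePoly i).eval y * (legendrePoly j).eval y) (by positivity)]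
  have e1 : 2 / (T - t) * t - (T + t) / (T - t) = -1 := by field_simp; ring
  have e2 : 2 / (T - t) * T - (T + t) / (T - t) = 1 := by field_simp; ring
  rw [e1, e2, integral_legendrePoly_mul]
  split_ifs with hij
  · subst hij
    rw [Real.mul_self_sqrt (by positivity), smul_eq_mul]
    field_simp
  · simp

lemma continuous_legendreSys (t T : ℝ) (j : ℕ) : Continuous (legendreSys t T j) := by
  have : legendreSys t T j = fun x => √((2 * j + 1) / (T - t)) *
      (legendrePoly j).eval ((2 * x - (T + t)) / (T - t)) := by
    ext x
    rw [legendreSys, legendreP_eq_eval]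
  rw [this]
  exact continuous_const.mul ((legendrePoly j).continuous.comp (by fun_prop))

lemma exists_eval_eq_sum_legendreSys {t T : ℝ} (ht : t < T) {p : ℕ} {Q : ℝ[X]}
    (hQ : Q.natDegree ≤ p) :
    ∃ d : Fin (p + 1) → ℝ, ∀ x, Q.eval x = ∑ i, d i * legendreSys t T i x := by
  have hT : 0 < T - t := sub_pos.2 ht
  set Q' : ℝ[X] := Q.comp (C ((T - t) / 2) * X + C ((T + t) / 2)) with hQ'
  have hmem : Q' ∈ degreeLT ℝ (p + 1) := by
    rw [mem_degreeLT]
    refine degree_le_natDegree.trans_lt (Nat.cast_lt.2 ?_)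
    have h1 : Q'.natDegree ≤ _ := natDegree_comp_le
    have h2 := natDegree_linear_le (a := (T - t) / 2) (b := (T + t) / 2)
    have := Nat.mul_le_mul hQ h2
    omega
  set S : Polynomial.Sequence ℝ := ⟨legendrePoly, degree_legendrePoly⟩
  rw [← S.span_degreeLT fun i _ => (leadingCoeff_ne_zero.2 (S.ne_zero i)).isUnit] at hmem
  have himg : S '' Set.Iio (p + 1) = Set.range fun i : Fin (p + 1) => legendrePoly i := by
    ext q
    constructor
    · rintro ⟨i, hi, rfl⟩
      exact ⟨⟨i, hi⟩, rfl⟩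
    · rintro ⟨i, rfl⟩
      exact ⟨i, i.2, rfl⟩
  rw [himg, Submodule.mem_span_range_iff_exists_fun] at hmem
  obtain ⟨c, hc⟩ := hmem
  refine ⟨fun i => c i / √((2 * i + 1) / (T - t)), fun x => ?_⟩
  have hx : Q.eval x = Q'.eval ((2 * x - (T + t)) / (T - t)) := by
    rw [hQ', eval_comp]
    congr 1
    simp only [eval_add, eval_mul, eval_C, eval_X]
    field_simp
    ring
  rw [hx, ← hc, eval_finsetSum]
  refine Finset.sum_congr rfl fun i _ => ?_
  have : √((2 * i + 1) / (T - t)) ≠ 0 := by positivity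
  rw [legendreSys, legendreP_eq_eval, eval_smul, smul_eq_mul]
  field_simp

end Legendre

section OrderedTriples

open Set

/-- The function `f x * (g y * h z)` on the set `x < y < z`, extended by zero. -/
noncomputable def orderedMul (f g h : ℝ → ℝ) (w : ℝ × ℝ × ℝ) : ℝ :=
  if w.1 < w.2.1 ∧ w.2.1 < w.2.2 then f w.1 * (g w.2.1 * h w.2.2) else 0

lemma isBddMeas_orderedMul {f g h : ℝ → ℝ} (hf : IsBddMeas f) (hg : IsBddMeas g)
    (hh : IsBddMeas h) : IsBddMeas (orderedMul f g h) := by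
  have hmul : IsBddMeas fun w : ℝ × ℝ × ℝ => f w.1 * (g w.2.1 * h w.2.2) :=
    (hf.comp measurable_fst).mul
      ((hg.comp measurable_snd.fst).mul (hh.comp measurable_snd.snd))
  obtain ⟨C, hC⟩ := hmul.bound
  refine ⟨Measurable.ite ((measurableSet_lt measurable_fst measurable_snd.fst).inter
    (measurableSet_lt measurable_snd.fst measurable_snd.snd)) hmul.measurable measurable_const,
    C, fun w => ?_⟩
  rw [orderedMul]
  split_ifs
  · exact hC w
  · rw [abs_zero]
    exact (abs_nonneg _).trans (hC w)

lemma integral_le_of_nonneg_of_le {X : Type*} [MeasurableSpace X] {μ : Measure X}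
    [IsFiniteMeasure μ] {G : X → ℝ} {B : ℝ} (h0 : ∀ x, 0 ≤ G x) (hB : ∀ x, G x ≤ B) :
    ∫ x, G x ∂μ ≤ B * μ.real univ :=
  (le_abs_self _).trans (norm_integral_le_of_norm_le_const (ae_of_all _ fun x => by
    rw [Real.norm_of_nonneg (h0 x)]
    exact hB x))

lemma sqDefect_const_mul_le {X ι : Type*} [MeasurableSpace X] [Fintype ι]
    {μ : Measure X} {φ : ι → X → ℝ} {f : X → ℝ} {c D M : ℝ} (hD : 0 ≤ D)
    (hf : sqDefect μ φ f ≤ D) (hc : |c| ≤ M) :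
    sqDefect μ φ (fun x => c * f x) ≤ M ^ 2 * D := by
  rw [sqDefect_const_mul, ← sq_abs c]
  exact (mul_le_mul_of_nonneg_left hf (sq_nonneg _)).trans
    (mul_le_mul_of_nonneg_right (pow_le_pow_left₀ (abs_nonneg c) hc 2) hD)

lemma IsBddOrtho.sqDefect_orderedMul_le {ι : Type*} [Fintype ι] [DecidableEq ι] {μ : Measure ℝ}
    [IsFiniteMeasure μ] {φ : ι → ℝ → ℝ} (hφ : IsBddOrtho μ φ) {f g h : ℝ → ℝ} {M D : ℝ}
    (hf : IsBddMeas f) (hg : IsBddMeas g) (hh : IsBddMeas h) (hfM : ∀ x, |f x| ≤ M)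
    (hgM : ∀ x, |g x| ≤ M) (hhM : ∀ x, |h x| ≤ M) (hD : 0 ≤ D)
    (hfD : ∀ b, sqDefect μ φ ((Iio b).indicator f) ≤ D)
    (hgD : ∀ a b, sqDefect μ φ ((Ioo a b).indicator g) ≤ D)
    (hhD : ∀ a, sqDefect μ φ ((Ioi a).indicator h) ≤ D) :
    sqDefect (μ.prod (μ.prod μ))
        (fun (i : ι × ι × ι) w => φ i.1 w.1 * (φ i.2.1 w.2.1 * φ i.2.2 w.2.2))
        (orderedMul f g h) ≤
      3 * ((M ^ 2) ^ 2 * D * μ.real univ * μ.real univ) := by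
  have hF := isBddMeas_orderedMul hf hg hh
  have hM : 0 ≤ M := (abs_nonneg _).trans (hfM 0)
  have hcoef (P : Prop) [Decidable P] {u v : ℝ} (hu : |u| ≤ M) (hv : |v| ≤ M) :
      |if P then u * v else 0| ≤ M ^ 2 := by
    split_ifs
    · rw [abs_mul, pow_two]
      gcongr
    · rw [abs_zero]
      positivity
  have hx (q : ℝ × ℝ) : sqDefect μ φ (fun x => orderedMul f g h (x, q)) ≤ (M ^ 2) ^ 2 * D := by
    have : (fun x => orderedMul f g h (x, q)) =
        fun x => (if q.1 < q.2 then g q.1 * h q.2 else 0) * (Iio q.1).indicator f x := by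
      ext x
      by_cases h1 : x < q.1 <;> by_cases h2 : q.1 < q.2 <;> simp [orderedMul, h1, h2, mul_comm]
    rw [this]
    exact sqDefect_const_mul_le hD (hfD _) (hcoef _ (hgM _) (hhM _))
  have hy (x z : ℝ) :
      sqDefect μ φ (fun y => orderedMul f g h (x, y, z)) ≤ (M ^ 2) ^ 2 * D := by
    have : (fun y => orderedMul f g h (x, y, z)) =
        fun y => (if True then f x * h z else 0) * (Ioo x z).indicator g y := by
      ext y
      by_cases h1 : x < y <;> by_cases h2 : y < z <;> simp [orderedMul, h1, h2]
      ring
    rw [this]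
    exact sqDefect_const_mul_le hD (hgD _ _) (hcoef _ (hfM _) (hhM _))
  have hz (x y : ℝ) :
      sqDefect μ φ (fun z => orderedMul f g h (x, y, z)) ≤ (M ^ 2) ^ 2 * D := by
    have : (fun z => orderedMul f g h (x, y, z)) =
        fun z => (if x < y then f x * g y else 0) * (Ioi y).indicator h z := by
      ext z
      by_cases h1 : x < y <;> by_cases h2 : y < z <;> simp [orderedMul, h1, h2, mul_assoc]
    rw [this]
    exact sqDefect_const_mul_le hD (hhD _) (hcoef _ (hfM _) (hgM _))
  have hFx (x : ℝ) : IsBddMeas fun q : ℝ × ℝ => orderedMul f g h (x, q) :=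
    hF.comp measurable_prodMk_left
  have hyz (x : ℝ) : sqDefect (μ.prod μ) (fun (i : ι × ι) q => φ i.1 q.1 * φ i.2 q.2)
      (fun q => orderedMul f g h (x, q)) ≤
      (M ^ 2) ^ 2 * D * μ.real univ + (M ^ 2) ^ 2 * D * μ.real univ := by
    refine (hφ.sqDefect_prod_le hφ (hFx x)).trans (add_le_add ?_ ?_)
    · exact integral_le_of_nonneg_of_le
        (fun z => hφ.sqDefect_nonneg ((hFx x).comp measurable_prodMk_right)) fun z => hy x z
    · exact integral_le_of_nonneg_of_le
        (fun y => hφ.sqDefect_nonneg ((hFx x).comp measurable_prodMk_left)) fun y => hz x y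
  refine (hφ.sqDefect_prod_le (hφ.prod hφ) hF).trans ?_
  have h1 := integral_le_of_nonneg_of_le (μ := μ.prod μ)
    (fun q => hφ.sqDefect_nonneg (hF.comp (measurable_prodMk_right (y := q)))) hx
  have h2 := integral_le_of_nonneg_of_le (μ := μ)
    (fun x => (hφ.prod hφ).sqDefect_nonneg (hFx x)) hyz
  rw [← univ_prod_univ, measureReal_prod_prod] at h1
  linarith

lemma integral_Iio_indicator_restrict_Icc {t T u : ℝ} (hu : u ∈ Icc t T) (f : ℝ → ℝ) :
    ∫ x in Icc t T, (Iio u).indicator ((Icc t T).indicator f) x = ∫ x in t..u, f x := by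
  have h : Iio u ∩ Icc t T = Ico t u := by
    ext x
    simp only [mem_inter_iff, mem_Iio, mem_Icc, mem_Ico]
    exact ⟨fun h => ⟨h.2.1, h.1⟩, fun h => ⟨h.2, h.1, h.2.le.trans hu.2⟩⟩
  rw [integral_indicator measurableSet_Iio, Measure.restrict_restrict measurableSet_Iio, h,
    intervalIntegral.integral_of_le hu.1, integral_Ico_eq_integral_Ioo,
    integral_Ioc_eq_integral_Ioo]
  refine setIntegral_congr_fun measurableSet_Ioo fun x hx => ?_
  exact indicator_of_mem (s := Icc t T) ⟨hx.1.le, hx.2.le.trans hu.2⟩ f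

lemma integral_restrict_Icc_eq {t T : ℝ} (ht : t ≤ T) {f g : ℝ → ℝ} (h : EqOn f g (Icc t T)) :
    ∫ x in Icc t T, f x = ∫ x in t..T, g x := by
  rw [intervalIntegral.integral_of_le ht, ← integral_Icc_eq_integral_Ioc]
  exact setIntegral_congr_fun measurableSet_Icc h

lemma integral_orderedMul_indicator {t T : ℝ} (ht : t ≤ T) {f g h : ℝ → ℝ}
    (hf : IsBddMeas ((Icc t T).indicator f)) (hg : IsBddMeas ((Icc t T).indicator g))
    (hh : IsBddMeas ((Icc t T).indicator h)) :
    ∫ w, orderedMul ((Icc t T).indicator f) ((Icc t T).indicator g) ((Icc t T).indicator h) w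
      ∂((volume.restrict (Icc t T)).prod
        ((volume.restrict (Icc t T)).prod (volume.restrict (Icc t T)))) =
      simplexIntegral t [h, g, f] T := by
  have hF := isBddMeas_orderedMul hf hg hh
  rw [integral_prod_symm _ (hF.integrable _), integral_prod_symm _
    ((hF.integral_fst (volume.restrict (Icc t T))).integrable _)]
  refine integral_restrict_Icc_eq ht fun z hz => ?_
  have hx (y : ℝ) : ∫ x in Icc t T, orderedMul ((Icc t T).indicator f) ((Icc t T).indicator g)
      ((Icc t T).indicator h) (x, y, z) =
      h z * (Iio z).indicator ((Icc t T).indicator fun y => g y * simplexIntegral t [f] y) y := by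
    by_cases hy : y ∈ Icc t T
    · have : (fun x => orderedMul ((Icc t T).indicator f) ((Icc t T).indicator g)
          ((Icc t T).indicator h) (x, y, z)) = fun x => (if y < z then g y * h z else 0) *
          (Iio y).indicator ((Icc t T).indicator f) x := by
        ext x
        by_cases h1 : x < y <;> by_cases h2 : y < z <;>
          simp [orderedMul, h1, h2, indicator_of_mem hy, indicator_of_mem hz, mul_comm]
      rw [this, integral_const_mul, integral_Iio_indicator_restrict_Icc hy]
      by_cases h2 : y < z
      · simp [h2, indicator_of_mem hy, simplexIntegral]
        ring
      · simp [h2]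
    · simp [orderedMul, indicator_apply, hy]
  simp_rw [hx]
  rw [integral_const_mul, integral_Iio_indicator_restrict_Icc hz]
  rfl

lemma isBddMeas_indicator_Icc {t T : ℝ} {f : ℝ → ℝ} (hf : ContinuousOn f (Icc t T)) :
    IsBddMeas ((Icc t T).indicator f) := by
  obtain ⟨C, hC⟩ := isCompact_Icc.exists_bound_of_continuousOn hf
  refine ⟨?_, |C|, fun x => ?_⟩
  · rw [← piecewise_eq_indicator]
    exact hf.measurable_piecewise continuousOn_const measurableSet_Icc
  · by_cases hx : x ∈ Icc t T
    · rw [indicator_of_mem hx]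
      exact (hC x hx).trans (le_abs_self C)
    · rw [indicator_of_notMem hx, abs_zero]
      exact abs_nonneg C

end OrderedTriples

section LegendreSeries

open Set

/-- The Legendre system of `[t, T]`, extended by zero outside the interval. -/
noncomputable def legendreInd (t T : ℝ) (j : ℕ) : ℝ → ℝ := (Icc t T).indicator (legendreSys t T j)

lemma isBddOrtho_legendreInd {t T : ℝ} (ht : t < T) (n : ℕ) :
    IsBddOrtho (volume.restrict (Icc t T)) fun i : Fin n => legendreInd t T i where
  bddMeas i := isBddMeas_indicator_Icc (continuous_legendreSys t T i).continuousOn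
  ortho i j := by
    rw [integral_restrict_Icc_eq (g := fun x => legendreSys t T i x * legendreSys t T j x) ht.le,
      integral_legendreSys_mul ht]
    · simp [Fin.ext_iff]
    · intro x hx
      simp [legendreInd, indicator_of_mem hx]

lemma exists_sqDefect_legendreInd_le {t T : ℝ} (ht : t < T) {ψ : ℝ → ℝ}
    (hψ : ContDiffOn ℝ 1 ψ (Icc t T)) :
    ∃ C : ℝ, 0 ≤ C ∧ ∀ p : ℕ, 1 ≤ p → ∀ a b : ℝ,
      sqDefect (volume.restrict (Icc t T)) (fun i : Fin (p + 1) => legendreInd t T i)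
        ((Ioo a b).indicator ((Icc t T).indicator ψ)) ≤ C / p := by
  obtain ⟨C, hC0, hC⟩ := exists_polynomial_approx_indicator ht hψ
  refine ⟨C, hC0, fun p hp a b => ?_⟩
  obtain ⟨Q, hQ, hQC⟩ := hC p hp a b
  obtain ⟨d, hd⟩ := exists_eval_eq_sum_legendreSys ht hQ
  have hb := isBddMeas_indicator_Icc hψ.continuousOn
  obtain ⟨M, hM⟩ := hb.bound
  have hbd : IsBddMeas ((Ioo a b).indicator ((Icc t T).indicator ψ)) := by
    refine ⟨hb.measurable.indicator measurableSet_Ioo, M, fun x => ?_⟩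
    exact (norm_indicator_le_norm_self ((Icc t T).indicator ψ) x).trans (hM x)
  refine ((isBddOrtho_legendreInd ht (p + 1)).sqDefect_le hbd d).trans (le_of_eq_of_le ?_ hQC)
  refine setIntegral_congr_fun measurableSet_Icc fun x hx => ?_
  simp [hd, legendreInd, indicator_apply, hx.1, hx.2]

lemma orderedMul_mul (f g h f' g' h' : ℝ → ℝ) (w : ℝ × ℝ × ℝ) :
    orderedMul f g h w * (f' w.1 * (g' w.2.1 * h' w.2.2)) =
      orderedMul (fun x => f x * f' x) (fun x => g x * g' x) (fun x => h x * h' x) w := by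
  rw [orderedMul, orderedMul]
  split_ifs
  · ring
  · ring

lemma legCoef_eq_integral {t T : ℝ} (ht : t ≤ T) {ψ : Fin 3 → ℝ → ℝ}
    (hψ : ∀ l, ContinuousOn (ψ l) (Icc t T)) (j : Fin 3 → ℕ) :
    legCoef t T ψ j = ∫ w, orderedMul ((Icc t T).indicator (ψ 0)) ((Icc t T).indicator (ψ 1))
      ((Icc t T).indicator (ψ 2)) w * (legendreInd t T (j 0) w.1 *
        (legendreInd t T (j 1) w.2.1 * legendreInd t T (j 2) w.2.2))
      ∂((volume.restrict (Icc t T)).prod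
        ((volume.restrict (Icc t T)).prod (volume.restrict (Icc t T)))) := by
  have hb l : IsBddMeas ((Icc t T).indicator fun s => ψ l s * legendreSys t T (j l) s) :=
    isBddMeas_indicator_Icc ((hψ l).mul (continuous_legendreSys t T (j l)).continuousOn)
  have h := integral_orderedMul_indicator ht (hb 0) (hb 1) (hb 2)
  have hlist : legCoef t T ψ j = simplexIntegral t [fun s => ψ 2 s * legendreSys t T (j 2) s,
      fun s => ψ 1 s * legendreSys t T (j 1) s, fun s => ψ 0 s * legendreSys t T (j 0) s] T := by
    simp [legCoef, List.ofFn_succ]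
  rw [hlist, ← h]
  simp_rw [orderedMul_mul, legendreInd, indicator_mul]

lemma kernelK_eq_orderedMul (ψ : Fin 3 → ℝ → ℝ) (x : Fin 3 → ℝ) :
    kernelK ψ x = orderedMul (ψ 0) (ψ 1) (ψ 2) (x 0, x 1, x 2) := by
  have h : StrictMono x ↔ x 0 < x 1 ∧ x 1 < x 2 := by
    simp [Fin.strictMono_iff_lt_succ, Fin.forall_fin_succ]
  simp only [kernelK, orderedMul, h, Fin.prod_univ_three, mul_assoc]

lemma measurePreserving_piFinThree (μ : Measure ℝ) [SigmaFinite μ] :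
    MeasurePreserving (fun x : Fin 3 → ℝ => (x 0, x 1, x 2)) (Measure.pi fun _ => μ)
      (μ.prod (μ.prod μ)) :=
  ((MeasurePreserving.id μ).prod (measurePreserving_finTwoArrow μ)).comp
    (measurePreserving_piFinSuccAbove (fun _ : Fin 3 => μ) 0)

lemma integral_kernelK_sq {t T : ℝ} {ψ : Fin 3 → ℝ → ℝ}
    (hψ : ∀ l, ContinuousOn (ψ l) (Icc t T)) :
    ∫ x, (kernelK ψ x) ^ 2 ∂(boxMeasure t T 3) =
      ∫ w, orderedMul ((Icc t T).indicator (ψ 0)) ((Icc t T).indicator (ψ 1))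
        ((Icc t T).indicator (ψ 2)) w ^ 2 ∂((volume.restrict (Icc t T)).prod
          ((volume.restrict (Icc t T)).prod (volume.restrict (Icc t T)))) := by
  have hb l := isBddMeas_indicator_Icc (hψ l)
  have hmp := measurePreserving_piFinThree (volume.restrict (Icc t T))
  rw [← hmp.map_eq, integral_map hmp.measurable.aemeasurable
    (isBddMeas_orderedMul (hb 0) (hb 1) (hb 2)).sq.measurable.aestronglyMeasurable, boxMeasure]
  have hmem : ∀ᵐ x ∂(Measure.pi fun _ : Fin 3 => volume.restrict (Icc t T)),
      ∀ l, x l ∈ Icc t T := by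
    refine ae_all_iff.2 fun l => ?_
    exact (Measure.quasiMeasurePreserving_eval _ l).ae (ae_restrict_mem measurableSet_Icc)
  refine integral_congr_ae (hmem.mono fun x hx => ?_)
  simp only [kernelK_eq_orderedMul, orderedMul, indicator_of_mem (hx _)]

/-- Functions on `Fin 3` as triples. -/
def finThreeArrowEquiv (α : Type*) : (Fin 3 → α) ≃ α × α × α where
  toFun j := (j 0, j 1, j 2)
  invFun q := ![q.1, q.2.1, q.2.2]
  left_inv j := by
    ext l
    fin_cases l <;> rfl
  right_inv _ := rfl

lemma sqDefect_orderedMul_eq {t T : ℝ} (ht : t ≤ T) {ψ : Fin 3 → ℝ → ℝ}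
    (hψ : ∀ l, ContinuousOn (ψ l) (Icc t T)) (n : ℕ) :
    sqDefect ((volume.restrict (Icc t T)).prod
        ((volume.restrict (Icc t T)).prod (volume.restrict (Icc t T))))
      (fun (i : Fin n × Fin n × Fin n) w => legendreInd t T i.1 w.1 *
        (legendreInd t T i.2.1 w.2.1 * legendreInd t T i.2.2 w.2.2))
      (orderedMul ((Icc t T).indicator (ψ 0)) ((Icc t T).indicator (ψ 1))
        ((Icc t T).indicator (ψ 2))) =
    (∫ x, (kernelK ψ x) ^ 2 ∂(boxMeasure t T 3)) -
      ∑ j : Fin 3 → Fin n, (legCoef t T ψ fun l => (j l : ℕ)) ^ 2 := by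
  rw [sqDefect, integral_kernelK_sq hψ]
  congr 1
  refine (Fintype.sum_equiv (finThreeArrowEquiv (Fin n)) _ _ fun j => ?_).symm
  rw [legCoef_eq_integral ht hψ]
  rfl

end LegendreSeries

theorem stmt_16 (t T : ℝ) (ht : t < T) (ψ : Fin 3 → ℝ → ℝ)
    (hψ : ∀ l, ContDiffOn ℝ 1 (ψ l) (Set.Icc t T)) :
    ∃ C : ℝ, ∀ p : ℕ, 1 ≤ p →
      (0 ≤ (∫ x, (kernelK ψ x) ^ 2 ∂(boxMeasure t T 3)) -
          ∑ j : Fin 3 → Fin (p + 1), (legCoef t T ψ fun l => (j l : ℕ)) ^ 2) ∧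
      (∫ x, (kernelK ψ x) ^ 2 ∂(boxMeasure t T 3)) -
          ∑ j : Fin 3 → Fin (p + 1), (legCoef t T ψ fun l => (j l : ℕ)) ^ 2 ≤
        C / (p : ℝ) := by
  have hc l := (hψ l).continuousOn
  have hb l := isBddMeas_indicator_Icc (hc l)
  choose M hM using fun l => (hb l).bound
  choose D hD0 hD using fun l => exists_sqDefect_legendreInd_le ht (hψ l)
  have hM0 l : 0 ≤ M l := (abs_nonneg _).trans (hM l 0)
  have hM' l x : |(Set.Icc t T).indicator (ψ l) x| ≤ ∑ l, M l :=
    (hM l x).trans (Finset.single_le_sum (fun l _ => hM0 l) (Finset.mem_univ l))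
  set μ := (volume : Measure ℝ).restrict (Set.Icc t T)
  refine ⟨3 * (((∑ l, M l) ^ 2) ^ 2 * (∑ l, D l) * μ.real Set.univ * μ.real Set.univ),
    fun p hp => ?_⟩
  have hφ := isBddOrtho_legendreInd ht (p + 1)
  rw [← sqDefect_orderedMul_eq ht.le hc]
  refine ⟨(hφ.prod (hφ.prod hφ)).sqDefect_nonneg (isBddMeas_orderedMul (hb 0) (hb 1) (hb 2)), ?_⟩
  have hD' l a b : sqDefect μ (fun i : Fin (p + 1) => legendreInd t T i)
      ((Set.Ioo a b).indicator ((Set.Icc t T).indicator (ψ l))) ≤ (∑ l, D l) / p :=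
    (hD l p hp a b).trans (div_le_div_of_nonneg_right
      (Finset.single_le_sum (fun l _ => hD0 l) (Finset.mem_univ l)) p.cast_nonneg)
  refine (hφ.sqDefect_orderedMul_le (hb 0) (hb 1) (hb 2) (hM' 0) (hM' 1) (hM' 2)
    (div_nonneg (Finset.sum_nonneg fun l _ => hD0 l) p.cast_nonneg) (fun b => ?_) (hD' 1)
    (fun a => ?_)).trans (le_of_eq (by ring))
  · have h : (Set.Iio b).indicator ((Set.Icc t T).indicator (ψ 0)) =
        (Set.Ioo (t - 1) b).indicator ((Set.Icc t T).indicator (ψ 0)) := by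
      ext x
      by_cases hx : x ∈ Set.Icc t T
      · have : t - 1 < x := by linarith [hx.1]
        simp [Set.indicator_apply, this]
      · simp only [Set.indicator_apply, if_neg hx, ite_self]
    exact h ▸ hD' 0 (t - 1) b
  · have h : (Set.Ioi a).indicator ((Set.Icc t T).indicator (ψ 2)) =
        (Set.Ioo a (T + 1)).indicator ((Set.Icc t T).indicator (ψ 2)) := by
      ext x
      by_cases hx : x ∈ Set.Icc t T
      · have : x < T + 1 := by linarith [hx.2]
        simp [Set.indicator_apply, this]
      · simp only [Set.indicator_apply, if_neg hx, ite_self]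
    exact h ▸ hD' 2 a (T + 1)
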